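/- Let J = (j_1, …, j_r) ∈ ℤ^r and δ = (d_1, …, d_r) ∈ C_J. If s_1 and s_2 are simple elements both satisfying property P(δ,J), and d ∈ B_n^+ is a greatest common left-divisor of s_1 and s_2, then d is a simple element satisfying property P(δ,J). In other words, the property P(δ,J) is closed under greatest common divisors. -/

import Mathlib

/-- The braid relations on `n` strands, with Artin generators indexed by `Fin (n-1)`:
`σᵢ σⱼ σᵢ = σⱼ σᵢ σⱼ` when `|i - j| = 1`, and `σᵢ σⱼ = σⱼ σᵢ` when `|i - j| ≥ 2`. -/
def braidRels (n : ℕ) : Set (FreeGroup (Fin (n - 1))) :=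
  {w | (∃ i j : Fin (n - 1), (i : ℕ) + 1 = (j : ℕ) ∧
          w = FreeGroup.of i * FreeGroup.of j * FreeGroup.of i *
              (FreeGroup.of j * FreeGroup.of i * FreeGroup.of j)⁻¹) ∨
       (∃ i j : Fin (n - 1), (i : ℕ) + 1 < (j : ℕ) ∧
          w = FreeGroup.of i * FreeGroup.of j * (FreeGroup.of j * FreeGroup.of i)⁻¹)}

/-- The braid group `B_n` on `n` strands. -/
abbrev BraidGroup (n : ℕ) := PresentedGroup (braidRels n)

/-- The Artin generator `σᵢ` of the braid group. -/
def braidGen (n : ℕ) (i : Fin (n - 1)) : BraidGroup n := PresentedGroup.of i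

/-- The monoid `B_n⁺` of positive braids: products of the generators with no inverses. -/
def PosBraid (n : ℕ) : Submonoid (BraidGroup n) :=
  Submonoid.closure (Set.range (braidGen n))

/-- Prefix order (left-divisibility): `a ≼ b` iff `a * c = b` for some positive `c`. -/
def PrefixLE (n : ℕ) (a b : BraidGroup n) : Prop :=
  ∃ c ∈ PosBraid n, a * c = b

/-- The Garside half-twist `Δ = (σ₁)(σ₂σ₁)⋯(σ_{n-1}⋯σ₁)`. -/
def braidDelta (n : ℕ) : BraidGroup n :=
  ((List.finRange (n - 1)).map (fun k =>
      ((((List.finRange (n - 1)).filter (fun i => decide (i ≤ k))).reverse.map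
        (braidGen n)).prod))).prod

/-- A simple element (permutation braid): a positive braid left-dividing `Δ`. -/
def IsSimple (n : ℕ) (s : BraidGroup n) : Prop :=
  s ∈ PosBraid n ∧ PrefixLE n s (braidDelta n)

/-- `InfGE n j a` means `inf(a) ≥ j`, i.e. `a = Δ^j p` for some positive braid `p`. -/
def InfGE (n : ℕ) (j : ℤ) (a : BraidGroup n) : Prop :=
  ∃ p ∈ PosBraid n, a = braidDelta n ^ j * p

/-- `β ∈ C^inf(α)`: `inf(β i) ≥ inf(α i)` for all `i` and `β` is simultaneously
conjugate to `α`. -/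
def CInf (n r : ℕ) (α β : Fin r → BraidGroup n) : Prop :=
  (∀ i, ∀ j : ℤ, InfGE n j (α i) → InfGE n j (β i)) ∧
  ∃ ω : BraidGroup n, ∀ i, β i = ω⁻¹ * α i * ω

/-- `δ ∈ C_J`: `inf(δ i) ≥ J i` for all `i`. -/
def CJ (n r : ℕ) (J : Fin r → ℤ) (δ : Fin r → BraidGroup n) : Prop :=
  ∀ i, InfGE n (J i) (δ i)

/-- Property `P(δ,J)` for a braid `s`: `inf(s⁻¹ δᵢ s) ≥ J i` for all `i`,
i.e. `s⁻¹ δ s ∈ C_J`. -/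
def PropP (n r : ℕ) (J : Fin r → ℤ) (δ : Fin r → BraidGroup n) (s : BraidGroup n) : Prop :=
  ∀ i, InfGE n (J i) (s⁻¹ * δ i * s)

/-- `s ∈ S_{δ,J}`: `s` is ≼-minimal among the nontrivial simple elements
satisfying `P(δ,J)`. -/
def MinSimple (n r : ℕ) (J : Fin r → ℤ) (δ : Fin r → BraidGroup n) (s : BraidGroup n) : Prop :=
  IsSimple n s ∧ s ≠ 1 ∧ PropP n r J δ s ∧
    ∀ t : BraidGroup n, IsSimple n t → t ≠ 1 → PropP n r J δ t → PrefixLE n t s → t = s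

/-- `d` is a greatest common left-divisor of `u` and `v` in `B_n⁺`. -/
def IsGCD (n : ℕ) (u v d : BraidGroup n) : Prop :=
  d ∈ PosBraid n ∧ PrefixLE n d u ∧ PrefixLE n d v ∧
    ∀ c ∈ PosBraid n, PrefixLE n c u → PrefixLE n c v → PrefixLE n c d

/-- `m` is a least common left-multiple of `u` and `v` in `B_n⁺`. -/
def IsLCM (n : ℕ) (u v m : BraidGroup n) : Prop :=
  m ∈ PosBraid n ∧ PrefixLE n u m ∧ PrefixLE n v m ∧
    ∀ c ∈ PosBraid n, PrefixLE n u c → PrefixLE n v c → PrefixLE n m c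

/-- One application of a defining relation of the simply-laced Artin monoid of the graph `G`:
adjacent generators satisfy the braid relation, distinct non-adjacent ones commute. -/
inductive ArtinStep {α : Type*} (G : SimpleGraph α) : List α → List α → Prop
  | cons (i : α) {x y : List α} : ArtinStep G x y → ArtinStep G (i :: x) (i :: y)
  | comm {i j : α} (z : List α) : i ≠ j → ¬ G.Adj i j → ArtinStep G (i :: j :: z) (j :: i :: z)
  | braid {i j : α} (z : List α) : G.Adj i j →
      ArtinStep G (i :: j :: i :: z) (j :: i :: j :: z)

namespace ArtinStep

variable {α : Type*} {G : SimpleGraph α}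

theorem symm {x y : List α} (h : ArtinStep G x y) : ArtinStep G y x := by
  induction h with
  | cons i _ ih => exact .cons i ih
  | comm z hij hadj => exact .comm z hij.symm (fun h => hadj h.symm)
  | braid z hadj => exact .braid z hadj.symm

theorem append_left (w : List α) {x y : List α} (h : ArtinStep G x y) :
    ArtinStep G (w ++ x) (w ++ y) := by
  induction w with
  | nil => exact h
  | cons i _ ih => exact .cons i ih

theorem append_right (w : List α) {x y : List α} (h : ArtinStep G x y) :
    ArtinStep G (x ++ w) (y ++ w) := by
  induction h with
  | cons i _ ih => exact .cons i ih
  | comm z hij hadj => exact .comm (z ++ w) hij hadj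
  | braid z hadj => exact .braid (z ++ w) hadj

end ArtinStep

/-- The congruence on words generated by the relations of the Artin monoid of `G`. -/
def artinCon {α : Type*} (G : SimpleGraph α) : Con (FreeMonoid α) where
  r x y := Relation.ReflTransGen (ArtinStep G) x.toList y.toList
  iseqv :=
    { refl := fun _ => .refl
      symm := fun h => by
        have : Std.Symm (ArtinStep G) := ⟨fun _ _ => ArtinStep.symm⟩
        exact Std.Symm.symm _ _ h
      trans := fun h₁ h₂ => h₁.trans h₂ }
  mul' {w x y z} h₁ h₂ :=
    (h₁.lift (· ++ y.toList) fun _ _ => ArtinStep.append_right y.toList).trans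
      (h₂.lift (x.toList ++ ·) fun _ _ => ArtinStep.append_left x.toList)

/-- The simply-laced Artin monoid of the graph `G`. -/
abbrev ArtinMonoid {α : Type*} (G : SimpleGraph α) := (artinCon G).Quotient

namespace ArtinMonoid

variable {α : Type*} {G : SimpleGraph α}

/-- The class of a word in the Artin monoid. -/
def word (G : SimpleGraph α) (w : List α) : ArtinMonoid G := (artinCon G).mk' (FreeMonoid.ofList w)

/-- The generators of the Artin monoid. -/
def gen (G : SimpleGraph α) (i : α) : ArtinMonoid G := word G [i]

theorem word_cons (i : α) (w : List α) : word G (i :: w) = gen G i * word G w := by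
  unfold gen word
  rw [← map_mul]
  rfl

theorem word_surjective (x : ArtinMonoid G) : ∃ w, word G w = x := by
  obtain ⟨w, rfl⟩ := (artinCon G).mk'_surjective x
  exact ⟨w.toList, rfl⟩

theorem word_eq_word {x y : List α} :
    word G x = word G y ↔ Relation.ReflTransGen (ArtinStep G) x y :=
  (artinCon G).eq

theorem induction_gen {P : ArtinMonoid G → Prop} (h1 : P 1)
    (hg : ∀ i x, P x → P (gen G i * x)) (x : ArtinMonoid G) : P x := by
  obtain ⟨w, rfl⟩ := word_surjective x
  induction w with
  | nil => exact h1
  | cons i w ih => exact word_cons (G := G) i w ▸ hg i _ ih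

theorem gen_comm {i j : α} (hij : i ≠ j) (h : ¬ G.Adj i j) (z : ArtinMonoid G) :
    gen G i * (gen G j * z) = gen G j * (gen G i * z) := by
  obtain ⟨w, rfl⟩ := word_surjective z
  simp only [← word_cons]
  exact word_eq_word.2 (.single (.comm w hij h))

theorem gen_braid {i j : α} (h : G.Adj i j) (z : ArtinMonoid G) :
    gen G i * (gen G j * (gen G i * z)) = gen G j * (gen G i * (gen G j * z)) := by
  obtain ⟨w, rfl⟩ := word_surjective z
  simp only [← word_cons]
  exact word_eq_word.2 (.single (.braid w h))

/-- The homomorphism out of the Artin monoid determined by images of the generators. -/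
def lift {N : Type*} [Monoid N] (f : α → N)
    (hc : ∀ i j, i ≠ j → ¬ G.Adj i j → f i * f j = f j * f i)
    (hb : ∀ i j, G.Adj i j → f i * f j * f i = f j * f i * f j) : ArtinMonoid G →* N :=
  (artinCon G).lift (FreeMonoid.lift f) <| by
    intro x y h
    have key : ∀ x y : List α, ArtinStep G x y →
        FreeMonoid.lift f (FreeMonoid.ofList x) = FreeMonoid.lift f (FreeMonoid.ofList y) := by
      intro x y h
      induction h with
      | cons i _ ih => simpa [FreeMonoid.ofList_cons] using congrArg (f i * ·) ih
      | comm z hij hadj =>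
        simp only [FreeMonoid.ofList_cons, map_mul, FreeMonoid.lift_eval_of, ← mul_assoc,
          hc _ _ hij hadj]
      | braid z hadj =>
        simp only [FreeMonoid.ofList_cons, map_mul, FreeMonoid.lift_eval_of, ← mul_assoc,
          hb _ _ hadj]
    have h' : Relation.ReflTransGen (ArtinStep G) x.toList y.toList := h
    change FreeMonoid.lift f (FreeMonoid.ofList x.toList) =
      FreeMonoid.lift f (FreeMonoid.ofList y.toList)
    generalize x.toList = a, y.toList = b at h'
    induction h' with
    | refl => rfl
    | tail _ hstep ih => exact ih.trans (key _ _ hstep)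

theorem lift_gen {N : Type*} [Monoid N] (f : α → N)
    (hc : ∀ i j, i ≠ j → ¬ G.Adj i j → f i * f j = f j * f i)
    (hb : ∀ i j, G.Adj i j → f i * f j * f i = f j * f i * f j) (i : α) :
    lift f hc hb (gen G i) = f i := by
  simp [lift, gen, word]

/-- The common length of all words representing an element. -/
def len (x : ArtinMonoid G) : ℕ :=
  Multiplicative.toAdd (lift (fun _ => Multiplicative.ofAdd 1) (fun _ _ _ _ => rfl)
    (fun _ _ _ => rfl) x)

theorem len_mul (x y : ArtinMonoid G) : len (x * y) = len x + len y := by simp [len]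

theorem len_gen (i : α) : len (gen G i) = 1 := by simp [len, lift_gen]

open Classical in
/-- The complement of `i` by `j`: `gen i * compl i j` is the least common right-multiple of the
generators `i` and `j`. -/
noncomputable def compl (G : SimpleGraph α) (i j : α) : ArtinMonoid G :=
  if i = j then 1 else if G.Adj i j then gen G j * gen G i else gen G j

theorem compl_self (i : α) : compl G i i = 1 := by simp [compl]

theorem compl_adj {i j : α} (h : G.Adj i j) : compl G i j = gen G j * gen G i := by
  simp [compl, h.ne, h]

theorem compl_nonadj {i j : α} (hij : i ≠ j) (h : ¬ G.Adj i j) : compl G i j = gen G j := by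
  simp [compl, hij, h]

theorem gen_mul_compl (i j : α) : gen G i * compl G i j = gen G j * compl G j i := by
  by_cases hij : i = j
  · rw [hij]
  by_cases h : G.Adj i j
  · simpa [compl_adj h, compl_adj h.symm] using gen_braid h 1
  · simpa [compl_nonadj hij h, compl_nonadj (Ne.symm hij) (fun h' => h h'.symm)]
      using gen_comm hij h 1

/-- Garside's property in length `m`: whenever `gen i * x = gen j * y` with `x` of length `m`,
both sides are multiples of the least common multiple of the two generators. -/
def Factors (G : SimpleGraph α) (m : ℕ) : Prop :=
  ∀ i j (x y : ArtinMonoid G), len x = m → gen G i * x = gen G j * y →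
    ∃ z, x = compl G i j * z ∧ y = compl G j i * z

theorem Factors.trans_aux_mixed {m : ℕ} (H : ∀ m' < m, Factors G m') {i j k : α}
    (hik : G.Adj i k) (hjk : ¬ G.Adj j k) (hjk' : j ≠ k) (hij' : i ≠ j)
    {u v : ArtinMonoid G} (hm : len (compl G k i * u) = m)
    (h : compl G k i * u = compl G k j * v) :
    ∃ z, compl G i k * u = compl G i j * z ∧ compl G j k * v = compl G j i * z := by
  have hkj : ¬ G.Adj k j := fun h => hjk h.symm
  simp only [compl_adj hik, compl_adj hik.symm, compl_nonadj hjk' hjk,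
    compl_nonadj hjk'.symm hkj, mul_assoc] at *
  simp only [len_mul, len_gen] at hm
  obtain ⟨t, ht, rfl⟩ := H (1 + len u) (by omega) i j _ _ (by simp [len_mul, len_gen]) h
  by_cases hij : G.Adj i j
  · simp only [compl_adj hij, compl_adj hij.symm, mul_assoc] at *
    have hl := congrArg len ht
    simp only [len_mul, len_gen] at hl
    obtain ⟨s, rfl, hs⟩ := H (len u) (by omega) k j _ _ rfl ht
    simp only [compl_nonadj hjk' hjk, compl_nonadj hjk'.symm hkj] at *
    simp only [len_mul, len_gen] at hl hm
    obtain ⟨w, rfl, rfl⟩ := H (len t) (by omega) i k _ _ rfl hs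
    simp only [compl_adj hik, compl_adj hik.symm, mul_assoc] at *
    refine ⟨gen G k * (gen G i * (gen G j * w)), ?_, ?_⟩
    · rw [gen_braid hij, gen_comm hjk'.symm hkj, gen_comm hjk' hjk w, gen_braid hik.symm]
    · rw [gen_comm hjk' hjk (gen G i * w), gen_braid hik.symm, gen_braid hij,
        gen_comm hjk'.symm hkj]
  · have hji : ¬ G.Adj j i := fun h => hij h.symm
    simp only [compl_nonadj hij' hij, compl_nonadj hij'.symm hji] at *
    obtain ⟨w, rfl, rfl⟩ := H (len u) (by omega) k j _ _ rfl ht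
    simp only [compl_nonadj hjk' hjk, compl_nonadj hjk'.symm hkj] at *
    refine ⟨gen G k * (gen G i * w), ?_, ?_⟩
    · rw [gen_comm hij' hij, gen_comm hjk'.symm hkj]
    · rw [gen_braid hik]

theorem Factors.trans_aux_comm {m : ℕ} (H : ∀ m' < m, Factors G m') {i j k : α}
    (hik : ¬ G.Adj i k) (hik' : i ≠ k) (hjk : ¬ G.Adj j k) (hjk' : j ≠ k)
    {u v : ArtinMonoid G} (hm : len (compl G k i * u) = m)
    (h : compl G k i * u = compl G k j * v) :
    ∃ z, compl G i k * u = compl G i j * z ∧ compl G j k * v = compl G j i * z := by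
  have hkj : ¬ G.Adj k j := fun h => hjk h.symm
  have hki : ¬ G.Adj k i := fun h => hik h.symm
  simp only [compl_nonadj hjk' hjk, compl_nonadj hjk'.symm hkj, compl_nonadj hik' hik,
    compl_nonadj hik'.symm hki] at *
  simp only [len_mul, len_gen] at hm
  obtain ⟨w, rfl, rfl⟩ := H (len u) (by omega) i j _ _ rfl h
  have comm : ∀ a b, (a = i ∨ a = j) → (b = i ∨ b = j) →
      gen G k * (compl G a b * w) = compl G a b * (gen G k * w) := by
    have hc : ∀ a, (a = i ∨ a = j) → ∀ z, gen G k * (gen G a * z) = gen G a * (gen G k * z) := by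
      rintro a (rfl | rfl) z
      · exact gen_comm hik'.symm hki z
      · exact gen_comm hjk'.symm hkj z
    intro a b ha hb
    unfold compl
    split_ifs
    · simp
    · rw [mul_assoc, mul_assoc, hc b hb, hc a ha]
    · rw [hc b hb]
  exact ⟨gen G k * w, comm i j (.inl rfl) (.inr rfl), comm j i (.inr rfl) (.inl rfl)⟩

theorem Factors.trans_aux_adj {m : ℕ} (H : ∀ m' < m, Factors G m') {i j k : α}
    (hik : G.Adj i k) (hjk : G.Adj j k) (hij : ¬ G.Adj i j) (hij' : i ≠ j)
    {u v : ArtinMonoid G} (hm : len (compl G k i * u) = m)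
    (h : compl G k i * u = compl G k j * v) :
    ∃ z, compl G i k * u = compl G i j * z ∧ compl G j k * v = compl G j i * z := by
  have hji : ¬ G.Adj j i := fun h => hij h.symm
  have hl := congrArg len h
  simp only [compl_adj hik, compl_adj hik.symm, compl_adj hjk, compl_adj hjk.symm,
    compl_nonadj hij' hij, compl_nonadj hij'.symm hji, mul_assoc] at *
  simp only [len_mul, len_gen] at hm hl
  obtain ⟨t, ht, ht'⟩ := H (1 + len u) (by omega) i j _ _ (by simp [len_mul, len_gen]) h
  simp only [compl_nonadj hij' hij, compl_nonadj hij'.symm hji] at *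
  obtain ⟨p, rfl, hp⟩ := H (len u) (by omega) k j _ _ rfl ht
  obtain ⟨q, rfl, hq⟩ := H (len v) (by omega) k i _ _ rfl ht'
  simp only [compl_adj hik, compl_adj hik.symm, compl_adj hjk, compl_adj hjk.symm,
    mul_assoc] at *
  simp only [len_mul, len_gen] at hm hl
  obtain ⟨r, hr, hr'⟩ := H (1 + len p) (by omega) k k _ _ (by simp [len_mul, len_gen])
    (hp.symm.trans hq)
  have hpq : gen G j * p = gen G i * q := by
    rw [hr, hr']
  obtain ⟨w, rfl, rfl⟩ := H (len p) (by omega) j i _ _ rfl hpq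
  simp only [compl_nonadj hij' hij, compl_nonadj hij'.symm hji] at *
  refine ⟨gen G k * (gen G j * (gen G i * (gen G k * w))), ?_, ?_⟩
  · rw [gen_comm hij' hij, gen_braid hik, gen_braid hjk.symm]
  · rw [gen_comm hij'.symm hji, gen_braid hjk, gen_braid hik.symm, gen_comm hij' hij]

theorem Factors.trans_aux (hG : ∀ i j k, G.Adj i k → G.Adj j k → ¬ G.Adj i j) {m : ℕ}
    (H : ∀ m' < m, Factors G m') {i j k : α}
    {u v : ArtinMonoid G} (hm : len (compl G k i * u) = m)
    (h : compl G k i * u = compl G k j * v) :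
    ∃ z, compl G i k * u = compl G i j * z ∧ compl G j k * v = compl G j i * z := by
  by_cases hik' : i = k
  · subst hik'
    exact ⟨v, by simpa [compl_self] using h, rfl⟩
  by_cases hjk' : j = k
  · subst hjk'
    exact ⟨u, rfl, by simpa [compl_self] using h.symm⟩
  have cancel : ∀ (a : α) (x y : ArtinMonoid G), len x < m → gen G a * x = gen G a * y →
      x = y := by
    intro a x y hx hxy
    obtain ⟨z, rfl, rfl⟩ := H (len x) hx a a x y rfl hxy
    rfl
  by_cases hij' : i = j
  · subst hij'
    refine ⟨compl G i k * u, by simp [compl_self], ?_⟩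
    suffices u = v by simp [compl_self, this]
    by_cases hik : G.Adj i k
    · simp only [compl_adj hik.symm, mul_assoc, len_mul, len_gen] at hm h
      exact cancel k _ _ (by omega) (cancel i _ _ (by simp only [len_mul, len_gen]; omega) h)
    · rw [compl_nonadj (Ne.symm hik') (fun h => hik h.symm)] at hm h
      simp only [len_mul, len_gen] at hm
      exact cancel i _ _ (by omega) h
  by_cases hik : G.Adj i k <;> by_cases hjk : G.Adj j k
  · exact trans_aux_adj H hik hjk (hG i j k hik hjk) hij' hm h
  · exact trans_aux_mixed H hik hjk hjk' hij' hm h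
  · obtain ⟨z, h₁, h₂⟩ := trans_aux_mixed H hjk hik hik' (Ne.symm hij') (h ▸ hm) h.symm
    exact ⟨z, h₂, h₁⟩
  · exact trans_aux_comm H hik hik' hjk hjk' hm h

theorem factors (hG : ∀ i j k, G.Adj i k → G.Adj j k → ¬ G.Adj i j) (m : ℕ) : Factors G m := by
  induction m using Nat.strong_induction_on with
  | _ m H =>
  intro i j x y hx hxy
  obtain ⟨x, rfl⟩ := word_surjective x
  obtain ⟨y, rfl⟩ := word_surjective y
  rw [← word_cons, ← word_cons, word_eq_word] at hxy
  generalize hw : j :: y = w at hxy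
  induction hxy generalizing j y with
  | refl =>
    obtain ⟨rfl, rfl⟩ := List.cons.inj hw
    exact ⟨word G y, by simp [compl_self]⟩
  | tail hchain hstep ih =>
    have combine : ∀ (k : α) (a : List α) (v : ArtinMonoid G),
        (∃ z, word G x = compl G i k * z ∧ word G a = compl G k i * z) →
        gen G i * word G x = gen G k * word G a →
        word G a = compl G k j * v → word G y = compl G j k * v →
        ∃ z, word G x = compl G i j * z ∧ word G y = compl G j i * z := by
      rintro k a v ⟨u, hu, hu'⟩ hl hv hv'
      have hl := congrArg len hl
      simp only [len_mul, len_gen] at hl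
      rw [hu, hv']
      exact Factors.trans_aux hG H (by rw [← hu']; omega) (hu'.symm.trans hv)
    have eq_of : ∀ (k : α) (a : List α), Relation.ReflTransGen (ArtinStep G) (i :: x) (k :: a) →
        gen G i * word G x = gen G k * word G a := by
      intro k a h
      rw [← word_cons, ← word_cons, word_eq_word.2 h]
    cases hstep with
    | @cons k a b hab =>
      obtain ⟨rfl, rfl⟩ := List.cons.inj hw
      rw [← word_eq_word.2 (.single hab)]
      exact ih _ _ rfl
    | @comm k l z hkl hadj =>
      obtain ⟨rfl, rfl⟩ := List.cons.inj hw
      refine combine k _ (word G z) (ih k _ rfl) (eq_of _ _ hchain) ?_ ?_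
      · rw [compl_nonadj hkl hadj, word_cons]
      · rw [compl_nonadj hkl.symm (fun h => hadj h.symm), word_cons]
    | @braid k l z hadj =>
      obtain ⟨rfl, rfl⟩ := List.cons.inj hw
      refine combine k _ (word G z) (ih k _ rfl) (eq_of _ _ hchain) ?_ ?_
      · rw [compl_adj hadj, word_cons, word_cons, mul_assoc]
      · rw [compl_adj hadj.symm, word_cons, word_cons, mul_assoc]

theorem mul_left_cancel_of_triangleFree (hG : ∀ i j k, G.Adj i k → G.Adj j k → ¬ G.Adj i j)
    (a x y : ArtinMonoid G) (h : a * x = a * y) : x = y := by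
  induction a using induction_gen with
  | h1 => simpa using h
  | hg i a ih =>
    rw [mul_assoc, mul_assoc] at h
    obtain ⟨z, h₁, h₂⟩ := factors hG _ i i _ _ rfl h
    exact ih (h₁.trans h₂.symm)

theorem eq_one_or_gen_mul (x : ArtinMonoid G) : x = 1 ∨ ∃ i y, x = gen G i * y := by
  induction x using induction_gen with
  | h1 => exact .inl rfl
  | hg i a _ => exact .inr ⟨i, a, rfl⟩

theorem gen_mul_compl_dvd (hG : ∀ i j k, G.Adj i k → G.Adj j k → ¬ G.Adj i j) {i j : α}
    {x y : ArtinMonoid G} (h : gen G i * x = gen G j * y) : compl G i j ∣ x := by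
  obtain ⟨z, hz, -⟩ := factors hG _ i j x y rfl h
  exact ⟨z, hz⟩

/-- Two elements with a common right-multiple have a least common right-multiple. -/
theorem exists_lcm (hG : ∀ i j k, G.Adj i k → G.Adj j k → ¬ G.Adj i j)
    (u a b : ArtinMonoid G) (ha : a ∣ u) (hb : b ∣ u) :
    ∃ l, a ∣ l ∧ b ∣ l ∧ ∀ v, a ∣ v → b ∣ v → l ∣ v := by
  have cancel : ∀ {a x y : ArtinMonoid G}, a * x ∣ a * y → x ∣ y := by
    rintro a x y ⟨c, hc⟩
    exact ⟨c, mul_left_cancel_of_triangleFree hG a _ _ (by rw [hc, mul_assoc])⟩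
  induction hm : len u using Nat.strong_induction_on generalizing u a b with
  | _ m ih =>
  obtain rfl | ⟨i, a, rfl⟩ := eq_one_or_gen_mul a
  · exact ⟨b, one_dvd b, dvd_rfl, fun v _ h => h⟩
  obtain rfl | ⟨j, b, rfl⟩ := eq_one_or_gen_mul b
  · exact ⟨gen G i * a, dvd_rfl, one_dvd _, fun v h _ => h⟩
  obtain ⟨c, rfl⟩ := ha
  obtain ⟨d, hd⟩ := hb
  rw [mul_assoc, mul_assoc] at hd
  have hl := congrArg len hd
  simp only [len_mul, len_gen] at hm hl
  obtain ⟨l₁, ⟨e, rfl⟩, ⟨f, hf⟩, hmin₁⟩ := ih (len (a * c)) (by simp only [len_mul]; omega) (a * c)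
    a (compl G i j) (dvd_mul_right _ _) (gen_mul_compl_dvd hG hd) rfl
  have key : gen G i * (a * e) = gen G j * (compl G j i * f) := by
    rw [hf, ← mul_assoc, gen_mul_compl, mul_assoc]
  have hmin₁' : ∀ x y : ArtinMonoid G, gen G i * x = gen G j * y → a ∣ x →
      compl G j i * f ∣ y := by
    intro x y hxy hax
    have h := mul_dvd_mul_left (gen G i) (hmin₁ x hax (gen_mul_compl_dvd hG hxy))
    rw [key, hxy] at h
    exact cancel h
  obtain ⟨l₂, h₁, h₂, hmin₂⟩ := ih (len (b * d)) (by simp only [len_mul]; omega) (b * d)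
    (compl G j i * f) b (hmin₁' _ _ hd (dvd_mul_right _ _)) (dvd_mul_right _ _) rfl
  refine ⟨gen G j * l₂, ?_, mul_dvd_mul_left _ h₂, ?_⟩
  · refine dvd_trans ?_ (mul_dvd_mul_left (gen G j) h₁)
    rw [← key, ← mul_assoc]
    exact dvd_mul_right _ _
  · rintro _ ⟨v, rfl⟩ hv
    obtain ⟨w, hw⟩ := (dvd_mul_right (gen G j) b).trans hv
    rw [mul_assoc] at hw hv ⊢
    rw [hw] at hv ⊢
    exact mul_dvd_mul_left _ (hmin₂ w (hmin₁' _ _ hw (dvd_mul_right _ _)) (cancel hv))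

universe u in
/-- If every generator divides a central element `z`, then the Artin monoid embeds in a group. -/
theorem exists_injective_hom {α : Type u} {G : SimpleGraph α}
    (hG : ∀ i j k, G.Adj i k → G.Adj j k → ¬ G.Adj i j)
    (z : ArtinMonoid G) (hz : ∀ x, x * z = z * x) (hdvd : ∀ i, gen G i ∣ z) :
    ∃ (H : Type u) (_ : Group H) (f : ArtinMonoid G →* H), Function.Injective f := by
  have hzk : ∀ (k : ℕ) (x : ArtinMonoid G), x * z ^ k = z ^ k * x :=
    fun k x => Commute.pow_right (hz x) k
  have cancel := mul_left_cancel_of_triangleFree hG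
  have hpow : ∀ x : ArtinMonoid G, ∃ (k : ℕ) (y : ArtinMonoid G), x * y = z ^ k := by
    intro x
    induction x using induction_gen with
    | h1 => exact ⟨0, 1, by simp⟩
    | hg i x ih =>
      obtain ⟨k, y, hy⟩ := ih
      obtain ⟨c, hc⟩ := hdvd i
      refine ⟨k + 1, y * c, ?_⟩
      rw [mul_assoc, ← mul_assoc x, hy, ← hzk, ← mul_assoc, ← hc, pow_succ']
  choose k y hy using hpow
  let inst : OreLocalization.OreSet (⊤ : Submonoid (ArtinMonoid G)) :=
    { ore_right_cancel := by
        rintro r₁ r₂ ⟨s, hs⟩ h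
        refine ⟨1, ?_⟩
        have h' : r₁ * (s * y s) = r₂ * (s * y s) := by
          rw [← mul_assoc, ← mul_assoc]
          exact congrArg (· * y s) h
        rw [hy, hzk, hzk] at h'
        rw [cancel _ _ _ h']
      oreNum := fun r s => r * y s
      oreDenom := fun _ s => ⟨z ^ k s, trivial⟩
      ore_eq := by
        rintro r ⟨s, hs⟩
        have h : y s * s = z ^ k s :=
          cancel s _ _ (by rw [← mul_assoc, hy, hzk])
        change z ^ k s * r = r * y s * s
        rw [mul_assoc, h, hzk] }
  refine ⟨(OreLocalization (⊤ : Submonoid (ArtinMonoid G)) (ArtinMonoid G))ˣ, inferInstance,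
    IsUnit.liftRight OreLocalization.numeratorHom
      (fun x => OreLocalization.numerator_isUnit
        (⟨x, Submonoid.mem_top x⟩ : (⊤ : Submonoid (ArtinMonoid G)))), ?_⟩
  intro a b hab
  have h : (OreLocalization.numeratorHom a : OreLocalization (⊤ : Submonoid (ArtinMonoid G)) _) =
      OreLocalization.numeratorHom b := congrArg Units.val hab
  rw [OreLocalization.numeratorHom_apply, OreLocalization.numeratorHom_apply,
    OreLocalization.oreDiv_eq_iff] at h
  obtain ⟨u, v, h₁, h₂⟩ := h
  simp only [Submonoid.coe_one, mul_one] at h₂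
  rw [← h₂] at h₁
  exact (cancel _ _ _ h₁).symm

end ArtinMonoid

/-- The descending product `s (k-1) * ⋯ * s 0`. -/
def descProd {M : Type*} [Monoid M] (s : ℕ → M) : ℕ → M
  | 0 => 1
  | k + 1 => s k * descProd s k

/-- The half-twist on the first `k` generators. -/
def halfTwist {M : Type*} [Monoid M] (s : ℕ → M) : ℕ → M
  | 0 => 1
  | k + 1 => halfTwist s k * descProd s (k + 1)

section HalfTwist

variable {M : Type*} [Monoid M] {s : ℕ → M}

theorem map_descProd {N : Type*} [Monoid N] (f : M →* N) (s : ℕ → M) (k : ℕ) :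
    f (descProd s k) = descProd (f ∘ s) k := by
  induction k with
  | zero => simp [descProd]
  | succ k ih => simp [descProd, ih]

theorem map_halfTwist {N : Type*} [Monoid N] (f : M →* N) (s : ℕ → M) (k : ℕ) :
    f (halfTwist s k) = halfTwist (f ∘ s) k := by
  induction k with
  | zero => simp [halfTwist]
  | succ k ih => simp [halfTwist, ih, map_descProd]

theorem descProd_eq_prod (s : ℕ → M) (k : ℕ) :
    descProd s k = ((List.range k).reverse.map s).prod := by
  induction k with
  | zero => simp [descProd]
  | succ k ih => simp [descProd, ih, List.range_succ]

theorem halfTwist_eq_prod (s : ℕ → M) (k : ℕ) :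
    halfTwist s k = ((List.range k).map (fun i => descProd s (i + 1))).prod := by
  induction k with
  | zero => simp [halfTwist]
  | succ k ih => simp [halfTwist, ih, List.range_succ]

theorem descProd_succ' (s : ℕ → M) (j : ℕ) :
    descProd s (j + 1) = descProd (fun i => s (i + 1)) j * s 0 := by
  induction j with
  | zero => simp [descProd]
  | succ j ih =>
    rw [descProd, ih, ← mul_assoc]
    rfl

theorem commute_descProd (hc : ∀ i j, i + 1 < j → s i * s j = s j * s i) {i k : ℕ} (h : k < i) :
    s i * descProd s k = descProd s k * s i := by
  induction k with
  | zero => simp [descProd]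
  | succ k ih => rw [descProd, ← mul_assoc, ← hc k i h, mul_assoc, ih (by omega), mul_assoc]

theorem commute_halfTwist (hc : ∀ i j, i + 1 < j → s i * s j = s j * s i) {i k : ℕ} (h : k < i) :
    s i * halfTwist s k = halfTwist s k * s i := by
  induction k with
  | zero => simp [halfTwist]
  | succ k ih =>
    rw [halfTwist, ← mul_assoc, ih (by omega), mul_assoc, commute_descProd hc h, mul_assoc]

theorem gen_mul_descProd {N : ℕ} (hc : ∀ i j, i + 1 < j → s i * s j = s j * s i)
    (hb : ∀ i, i + 1 < N → s i * s (i + 1) * s i = s (i + 1) * s i * s (i + 1)) {i k : ℕ}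
    (hik : i < k) (hk : k < N) :
    s i * descProd s (k + 1) = descProd s (k + 1) * s (i + 1) := by
  induction k with
  | zero => omega
  | succ k ih =>
    obtain rfl | hlt := Nat.eq_or_lt_of_le (Nat.le_of_lt_succ hik)
    · have h := commute_descProd hc (Nat.lt_succ_self i)
      rw [descProd, descProd, ← mul_assoc, ← mul_assoc, hb i hk, mul_assoc _ (s (i + 1)), h]
      simp only [mul_assoc]
    · rw [descProd, ← mul_assoc, hc i (k + 1) (by omega), mul_assoc, ih hlt (by omega), mul_assoc]

theorem descProd_mul_descProd {N : ℕ} (hc : ∀ i j, i + 1 < j → s i * s j = s j * s i)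
    (hb : ∀ i, i + 1 < N → s i * s (i + 1) * s i = s (i + 1) * s i * s (i + 1)) {j k : ℕ}
    (hjk : j ≤ k) (hk : k < N) :
    descProd s (k + 1) * descProd (fun i => s (i + 1)) j = descProd s j * descProd s (k + 1) := by
  induction j with
  | zero => simp [descProd]
  | succ j ih =>
    have h₁ : descProd s (j + 1) = s j * descProd s j := rfl
    have h₂ : descProd (fun i => s (i + 1)) (j + 1) =
      s (j + 1) * descProd (fun i => s (i + 1)) j := rfl
    rw [h₁, h₂, ← mul_assoc, ← gen_mul_descProd hc hb (by omega) hk, mul_assoc, ih (by omega),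
      mul_assoc]

/-- Conjugation by the half-twist reverses the order of the generators. -/
theorem halfTwist_mul_gen {N : ℕ} (hc : ∀ i j, i + 1 < j → s i * s j = s j * s i)
    (hb : ∀ i, i + 1 < N → s i * s (i + 1) * s i = s (i + 1) * s i * s (i + 1)) {i j k : ℕ}
    (hij : i + j + 1 = k) (hk : k ≤ N) :
    halfTwist s k * s i = s j * halfTwist s k := by
  induction k generalizing i j with
  | zero => omega
  | succ k ih =>
    cases i with
    | succ i =>
      rw [halfTwist, mul_assoc, ← gen_mul_descProd hc hb (by omega) (by omega), ← mul_assoc,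
        ih (i := i) (j := j) (by omega) (by omega), mul_assoc]
    | zero =>
      obtain rfl : j = k := by omega
      cases j with
      | zero => simp [halfTwist, descProd]
      | succ j =>
        have h : descProd s (j + 2) * descProd s (j + 2) =
            descProd s (j + 1) * (descProd s (j + 2) * s 0) := by
          refine (congrArg (descProd s (j + 2) * ·) (descProd_succ' s (j + 1))).trans ?_
          rw [← mul_assoc, descProd_mul_descProd hc hb le_rfl (by omega), mul_assoc]
        rw [halfTwist, halfTwist, mul_assoc, mul_assoc, mul_assoc, ← h, ← mul_assoc (s (j + 1)),
          commute_halfTwist hc (Nat.lt_succ_self j), mul_assoc, ← mul_assoc (s (j + 1))]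
        rfl

theorem exists_halfTwist_eq_mul_gen {N : ℕ} (hc : ∀ i j, i + 1 < j → s i * s j = s j * s i)
    (hb : ∀ i, i + 1 < N → s i * s (i + 1) * s i = s (i + 1) * s i * s (i + 1)) {i k : ℕ}
    (hik : i < k) (hk : k ≤ N) : ∃ e, halfTwist s k = e * s i := by
  induction k generalizing i with
  | zero => omega
  | succ k ih =>
    cases i with
    | zero => exact ⟨_, by rw [halfTwist, descProd_succ', ← mul_assoc]⟩
    | succ i =>
      obtain ⟨e, he⟩ := ih (i := i) (by omega) (by omega)
      refine ⟨e * descProd s (k + 1), ?_⟩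
      rw [halfTwist, he, mul_assoc, gen_mul_descProd hc hb (by omega) (by omega), mul_assoc]

end HalfTwist

/-- The positive braid monoid, given by its presentation. -/
abbrev BraidMonoid (n : ℕ) := ArtinMonoid (SimpleGraph.pathGraph (n - 1))

namespace BraidMonoid

variable {n : ℕ}

theorem pathGraph_triangleFree (m : ℕ) (i j k : Fin m) (hik : (SimpleGraph.pathGraph m).Adj i k)
    (hjk : (SimpleGraph.pathGraph m).Adj j k) : ¬ (SimpleGraph.pathGraph m).Adj i j := by
  simp only [SimpleGraph.pathGraph_adj] at *
  omega

theorem mul_left_cancel (a x y : BraidMonoid n) (h : a * x = a * y) : x = y :=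
  ArtinMonoid.mul_left_cancel_of_triangleFree (pathGraph_triangleFree _) a x y h

/-- The generators, extended by `1`. -/
def genNat (n : ℕ) (i : ℕ) : BraidMonoid n :=
  if h : i < n - 1 then ArtinMonoid.gen _ ⟨i, h⟩ else 1

theorem genNat_of_lt {i : ℕ} (h : i < n - 1) : genNat n i = ArtinMonoid.gen _ ⟨i, h⟩ := dif_pos h

theorem genNat_comm (i j : ℕ) (hij : i + 1 < j) :
    genNat n i * genNat n j = genNat n j * genNat n i := by
  by_cases hj : j < n - 1
  · rw [genNat_of_lt hj, genNat_of_lt (by omega : i < n - 1)]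
    simpa using ArtinMonoid.gen_comm (G := SimpleGraph.pathGraph (n - 1)) (i := ⟨i, by omega⟩)
      (j := ⟨j, hj⟩) (by simp; omega) (by simp [SimpleGraph.pathGraph_adj]; omega) 1
  · simp [genNat, hj]

theorem genNat_braid (i : ℕ) (hi : i + 1 < n - 1) :
    genNat n i * genNat n (i + 1) * genNat n i =
      genNat n (i + 1) * genNat n i * genNat n (i + 1) := by
  rw [genNat_of_lt hi, genNat_of_lt (by omega : i < n - 1)]
  simpa [mul_assoc] using ArtinMonoid.gen_braid (G := SimpleGraph.pathGraph (n - 1))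
    (i := ⟨i, by omega⟩) (j := ⟨i + 1, hi⟩) (by simp [SimpleGraph.pathGraph_adj]) 1

/-- The Garside element. -/
def delta (n : ℕ) : BraidMonoid n := halfTwist (genNat n) (n - 1)

theorem delta_mul_gen (i : Fin (n - 1)) :
    delta n * ArtinMonoid.gen _ i = ArtinMonoid.gen _ i.rev * delta n := by
  have h := halfTwist_mul_gen (s := genNat n) genNat_comm genNat_braid (i := i) (j := i.rev)
    (k := n - 1) (by have := i.2; rw [Fin.val_rev]; omega) le_rfl
  rwa [genNat_of_lt i.2, genNat_of_lt i.rev.2] at h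

theorem exists_delta_mul (x : BraidMonoid n) : ∃ y, delta n * x = y * delta n := by
  induction x using ArtinMonoid.induction_gen with
  | h1 => exact ⟨1, by simp⟩
  | hg i x ih =>
    obtain ⟨y, hy⟩ := ih
    exact ⟨ArtinMonoid.gen _ i.rev * y, by rw [← mul_assoc, delta_mul_gen, mul_assoc, hy, mul_assoc]⟩

theorem exists_mul_delta (x : BraidMonoid n) : ∃ y, x * delta n = delta n * y := by
  induction x using ArtinMonoid.induction_gen with
  | h1 => exact ⟨1, by simp⟩
  | hg i x ih =>
    obtain ⟨y, hy⟩ := ih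
    refine ⟨ArtinMonoid.gen _ i.rev * y, ?_⟩
    rw [mul_assoc, hy, ← mul_assoc, ← mul_assoc, delta_mul_gen, Fin.rev_rev]

theorem mul_delta_sq (x : BraidMonoid n) :
    x * (delta n * delta n) = delta n * delta n * x := by
  induction x using ArtinMonoid.induction_gen with
  | h1 => simp
  | hg i x ih =>
    have h := delta_mul_gen (n := n) i.rev
    rw [Fin.rev_rev] at h
    rw [mul_assoc, ih, ← mul_assoc, ← mul_assoc, ← h, mul_assoc (delta n), ← delta_mul_gen]
    simp only [mul_assoc]

theorem gen_dvd_delta_sq (i : Fin (n - 1)) :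
    ArtinMonoid.gen (SimpleGraph.pathGraph (n - 1)) i ∣ delta n * delta n := by
  obtain ⟨e, he⟩ := exists_halfTwist_eq_mul_gen (s := genNat n) genNat_comm genNat_braid i.2 le_rfl
  rw [genNat_of_lt i.2] at he
  change delta n = e * ArtinMonoid.gen _ i at he
  refine ⟨delta n * e, mul_left_cancel (delta n * e) _ _ ?_⟩
  rw [mul_delta_sq, ← mul_assoc (delta n * e), mul_assoc (delta n) e (ArtinMonoid.gen _ i), ← he]

/-- The canonical homomorphism to the braid group. -/
def toGroup (n : ℕ) : BraidMonoid n →* BraidGroup n :=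
  ArtinMonoid.lift (braidGen n)
    (by
      have key : ∀ i j : Fin (n - 1), (i : ℕ) + 1 < j →
          braidGen n i * braidGen n j = braidGen n j * braidGen n i := fun i j h =>
        PresentedGroup.mk_eq_mk_of_mul_inv_mem (x := FreeGroup.of i * FreeGroup.of j)
          (y := FreeGroup.of j * FreeGroup.of i) (.inr ⟨i, j, h, rfl⟩)
      intro i j hij h
      have hij' : (i : ℕ) ≠ j := fun h => hij (Fin.ext h)
      rw [SimpleGraph.pathGraph_adj] at h
      rcases Nat.lt_or_gt_of_ne hij' with hlt | hlt
      · exact key i j (by omega)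
      · exact (key j i (by omega)).symm)
    (by
      have key : ∀ i j : Fin (n - 1), (i : ℕ) + 1 = j →
          braidGen n i * braidGen n j * braidGen n i =
            braidGen n j * braidGen n i * braidGen n j := fun i j h =>
        PresentedGroup.mk_eq_mk_of_mul_inv_mem
          (x := FreeGroup.of i * FreeGroup.of j * FreeGroup.of i)
          (y := FreeGroup.of j * FreeGroup.of i * FreeGroup.of j) (.inl ⟨i, j, h, rfl⟩)
      intro i j h
      rcases SimpleGraph.pathGraph_adj.1 h with h | h
      · exact key i j h
      · exact (key j i h).symm)

theorem toGroup_gen (i : Fin (n - 1)) : toGroup n (ArtinMonoid.gen _ i) = braidGen n i :=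
  ArtinMonoid.lift_gen _ _ _ i

theorem toGroup_injective : Function.Injective (toGroup n) := by
  obtain ⟨H, _, f, hf⟩ := ArtinMonoid.exists_injective_hom (pathGraph_triangleFree (n - 1))
    (delta n * delta n) mul_delta_sq gen_dvd_delta_sq
  have hrel : ∀ w ∈ braidRels n, FreeGroup.lift (fun i => f (ArtinMonoid.gen _ i)) w = 1 := by
    rintro _ (⟨i, j, h, rfl⟩ | ⟨i, j, h, rfl⟩)
    · rw [map_mul, map_inv, mul_inv_eq_one]
      simpa [mul_assoc] using congrArg f (ArtinMonoid.gen_braid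
        (G := SimpleGraph.pathGraph (n - 1)) (SimpleGraph.pathGraph_adj.2 (.inl h)) 1)
    · rw [map_mul, map_inv, mul_inv_eq_one]
      simpa using congrArg f (ArtinMonoid.gen_comm (G := SimpleGraph.pathGraph (n - 1))
        (i := i) (j := j) (by rintro rfl; omega)
        (by rw [SimpleGraph.pathGraph_adj]; omega) 1)
  have hcomp : ∀ x, PresentedGroup.toGroup hrel (toGroup n x) = f x := by
    intro x
    induction x using ArtinMonoid.induction_gen with
    | h1 => simp
    | hg i x ih =>
      rw [map_mul, map_mul, ih, toGroup_gen, map_mul]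
      exact congrArg (· * f x) (PresentedGroup.toGroup.of hrel)
  intro a b hab
  exact hf (by rw [← hcomp, ← hcomp, hab])

theorem mem_posBraid_iff {b : BraidGroup n} : b ∈ PosBraid n ↔ ∃ x, toGroup n x = b := by
  constructor
  · intro hb
    have hle : PosBraid n ≤ MonoidHom.mrange (toGroup n) := by
      rw [PosBraid, Submonoid.closure_le]
      rintro _ ⟨i, rfl⟩
      exact ⟨_, toGroup_gen i⟩
    exact hle hb
  · rintro ⟨x, rfl⟩
    induction x using ArtinMonoid.induction_gen with
    | h1 => simp [one_mem]
    | hg i x ih =>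
      rw [map_mul, toGroup_gen]
      exact mul_mem (Submonoid.subset_closure ⟨i, rfl⟩) ih

theorem prefixLE_toGroup {x y : BraidMonoid n} :
    PrefixLE n (toGroup n x) (toGroup n y) ↔ x ∣ y := by
  constructor
  · rintro ⟨c, hc, h⟩
    obtain ⟨z, rfl⟩ := mem_posBraid_iff.1 hc
    exact ⟨z, toGroup_injective (by rw [map_mul, h])⟩
  · rintro ⟨z, rfl⟩
    exact ⟨_, mem_posBraid_iff.2 ⟨z, rfl⟩, (map_mul _ _ _).symm⟩

theorem toGroup_delta : toGroup n (delta n) = braidDelta n := by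
  have hg : ∀ i : Fin (n - 1), braidGen n i = (toGroup n ∘ genNat n) i := fun i => by
    rw [Function.comp_apply, genNat_of_lt i.2, toGroup_gen]
  have hfilter : ∀ k < n - 1,
      (List.range (n - 1)).filter (fun i => decide (i ≤ k)) = List.range (k + 1) := by
    intro k hk
    obtain ⟨m, hm⟩ : ∃ m, n - 1 = k + 1 + m := ⟨n - 1 - (k + 1), by omega⟩
    rw [hm, List.range_add, List.filter_append, List.filter_eq_self.2, List.filter_eq_nil_iff.2,
      List.append_nil]
    · simp
      omega
    · simp
  have hmap : (List.finRange (n - 1)).map (fun i : Fin (n - 1) => (i : ℕ)) = List.range (n - 1) := by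
    simp
  rw [delta, map_halfTwist, halfTwist_eq_prod, braidDelta, ← hmap, List.map_map]
  congr 1
  refine List.map_congr_left fun k _ => ?_
  rw [Function.comp_apply, descProd_eq_prod, ← hfilter k k.2, ← hmap, List.filter_map,
    ← List.map_reverse, List.map_map]
  congr 1
  exact List.map_congr_left fun i _ => (hg i).symm

end BraidMonoid

open BraidMonoid

theorem PrefixLE.trans {n : ℕ} {a b c : BraidGroup n} (h₁ : PrefixLE n a b)
    (h₂ : PrefixLE n b c) : PrefixLE n a c := by
  obtain ⟨x, hx, rfl⟩ := h₁
  obtain ⟨y, hy, rfl⟩ := h₂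
  exact ⟨x * y, mul_mem hx hy, (mul_assoc _ _ _).symm⟩

theorem prefixLE_mul_left_iff {n : ℕ} (a : BraidGroup n) {b c : BraidGroup n} :
    PrefixLE n (a * b) (a * c) ↔ PrefixLE n b c := by
  simp [PrefixLE, mul_assoc]

theorem conj_braidDelta_zpow_mem {n : ℕ} (j : ℤ) {p : BraidGroup n} (hp : p ∈ PosBraid n) :
    (braidDelta n ^ j)⁻¹ * p * braidDelta n ^ j ∈ PosBraid n := by
  induction j using Int.induction_on generalizing p with
  | zero => simpa using hp
  | succ k ih =>
    obtain ⟨x, hx⟩ := mem_posBraid_iff.1 (ih hp)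
    obtain ⟨y, hy⟩ := exists_mul_delta x
    refine mem_posBraid_iff.2 ⟨y, ?_⟩
    have h := congrArg (toGroup n) hy
    rw [map_mul, map_mul, toGroup_delta, hx] at h
    rw [zpow_add_one, mul_inv_rev, eq_inv_mul_iff_mul_eq.2 h.symm]
    simp only [mul_assoc]
  | pred k ih =>
    obtain ⟨x, hx⟩ := mem_posBraid_iff.1 (ih hp)
    obtain ⟨y, hy⟩ := exists_delta_mul x
    refine mem_posBraid_iff.2 ⟨y, ?_⟩
    have h := congrArg (toGroup n) hy
    rw [map_mul, map_mul, toGroup_delta, hx] at h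
    rw [zpow_sub_one, mul_inv_rev, inv_inv, eq_mul_inv_of_mul_eq h.symm]
    simp only [mul_assoc]

/-- Two positive braids with a common right-multiple have a least common right-multiple. -/
theorem exists_isLCM {n : ℕ} {a b u : BraidGroup n} (ha : a ∈ PosBraid n) (hb : b ∈ PosBraid n)
    (hu : u ∈ PosBraid n) (hau : PrefixLE n a u) (hbu : PrefixLE n b u) : ∃ l, IsLCM n a b l := by
  obtain ⟨a, rfl⟩ := mem_posBraid_iff.1 ha
  obtain ⟨b, rfl⟩ := mem_posBraid_iff.1 hb
  obtain ⟨u, rfl⟩ := mem_posBraid_iff.1 hu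
  obtain ⟨l, hal, hbl, hmin⟩ := ArtinMonoid.exists_lcm (pathGraph_triangleFree _) u a b
    (prefixLE_toGroup.1 hau) (prefixLE_toGroup.1 hbu)
  refine ⟨toGroup n l, mem_posBraid_iff.2 ⟨l, rfl⟩, prefixLE_toGroup.2 hal,
    prefixLE_toGroup.2 hbl, fun c hc hac hbc => ?_⟩
  obtain ⟨c, rfl⟩ := mem_posBraid_iff.1 hc
  exact prefixLE_toGroup.2 (hmin c (prefixLE_toGroup.1 hac) (prefixLE_toGroup.1 hbc))

/-- The condition `inf (s⁻¹ Δʲ p s) ≥ j` says that the conjugate of `s` by `Δʲ` left-divides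
`p s`. -/
theorem infGE_conj_iff {n : ℕ} (j : ℤ) (p s : BraidGroup n) :
    InfGE n j (s⁻¹ * (braidDelta n ^ j * p) * s) ↔
      PrefixLE n ((braidDelta n ^ j)⁻¹ * s * braidDelta n ^ j) (p * s) := by
  refine exists_congr fun q => and_congr_right fun _ => ⟨fun h => ?_, fun h => ?_⟩
  · rw [mul_assoc _ _ q, ← h]
    group
  · rw [mul_assoc _ _ s, mul_assoc _ p s, ← h]
    group

/-- the property `P(δ,J)` is closed under greatest common
left-divisors: a gcd of two simple elements satisfying `P(δ,J)` is again a simple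
element satisfying `P(δ,J)`. -/
theorem stmt3 (n r : ℕ) (hn : 2 ≤ n) (J : Fin r → ℤ) (δ : Fin r → BraidGroup n)
    (hδ : CJ n r J δ) (s₁ s₂ : BraidGroup n)
    (hs₁ : IsSimple n s₁) (hs₂ : IsSimple n s₂)
    (hP₁ : PropP n r J δ s₁) (hP₂ : PropP n r J δ s₂)
    (d : BraidGroup n) (hd : IsGCD n s₁ s₂ d) :
    IsSimple n d ∧ PropP n r J δ d := by
  obtain ⟨hdpos, hd₁, hd₂, hgcd⟩ := hd
  refine ⟨⟨hdpos, hd₁.trans hs₁.2⟩, fun i => ?_⟩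
  obtain ⟨p, hp, hδi⟩ := hδ i
  have key : ∀ s, PropP n r J δ s → PrefixLE n d s →
      PrefixLE n ((braidDelta n ^ J i)⁻¹ * d * braidDelta n ^ J i) (p * s) := by
    intro s hP hds
    have h := hP i
    rw [hδi, infGE_conj_iff] at h
    refine PrefixLE.trans ?_ h
    obtain ⟨c, hc, rfl⟩ := hds
    exact ⟨_, conj_braidDelta_zpow_mem (J i) hc, by group⟩
  obtain ⟨l, -, ⟨l', hl', rfl⟩, hl, hmin⟩ := exists_isLCM hp
    (conj_braidDelta_zpow_mem (J i) hdpos) (mul_mem hp hs₁.1) ⟨s₁, hs₁.1, rfl⟩ (key s₁ hP₁ hd₁)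
  have hl's : ∀ s, s ∈ PosBraid n → PropP n r J δ s → PrefixLE n d s → PrefixLE n l' s :=
    fun s hs hP hds => (prefixLE_mul_left_iff p).1
      (hmin _ (mul_mem hp hs) ⟨s, hs, rfl⟩ (key s hP hds))
  rw [hδi, infGE_conj_iff]
  exact hl.trans ((prefixLE_mul_left_iff p).2
    (hgcd l' hl' (hl's s₁ hs₁.1 hP₁ hd₁) (hl's s₂ hs₂.1 hP₂ hd₂)))
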